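/- arXiv:2509.10941 — 6 statements merged into one kernel-verified Lean document; each statement's English description precedes it below -/
import Mathlib

section
/- Let G be a simple graph that is both claw-free and butterfly-free, let k ≥ 3 and t ≥ 1 be integers, let u_1, u_2, …, u_{k+1} be the vertices, in order, of an induced path in G, and let v_1, …, v_t be distinct vertices of G, none lying on the path, each adjacent to u_{k+1}, and none adjacent to u_k. Suppose there exist indices i with 2 ≤ i ≤ k−1 and j ∈ {1, …, t} such that v_j is adjacent to both u_i and u_{i-1}. Then for every q ∈ {1, …, t}, the vertex v_q is adjacent to u_i or to u_{i-1}. -/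
/-- The claw `K_{1,3}`: the star on four vertices with center `0`. -/
def claw : SimpleGraph (Fin 4) := SimpleGraph.fromRel (fun i _ => i = 0)

/-- The butterfly: two triangles `{0,1,2}` and `{0,3,4}` sharing the vertex `0`. -/
def butterfly : SimpleGraph (Fin 5) :=
  SimpleGraph.fromRel (fun i j => i = 0 ∨ (i = 1 ∧ j = 2) ∨ (i = 3 ∧ j = 4))

/-- A graph is `H`-free if it contains no induced subgraph isomorphic to `H`,
i.e. there is no graph embedding of `H` into it. -/
def InducedFree {W V : Type*} (H : SimpleGraph W) (G : SimpleGraph V) : Prop :=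
  IsEmpty (H ↪g G)

/-- In a claw-free graph, two of three distinct neighbors of a vertex are adjacent. -/
theorem InducedFree.adj_of_claw {V : Type*} {G : SimpleGraph V} (h : InducedFree claw G)
    {c x y z : V} (hx : G.Adj c x) (hy : G.Adj c y) (hz : G.Adj c z)
    (hxy : x ≠ y) (hxz : x ≠ z) (hyz : y ≠ z) :
    G.Adj x y ∨ G.Adj x z ∨ G.Adj y z := by
  by_contra! hn
  obtain ⟨h₁, h₂, h₃⟩ := hn
  refine h.false ⟨⟨![c, x, y, z], ?_⟩, ?_⟩
  · intro a b hab
    fin_cases a <;> fin_cases b <;>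
      simp_all [hx.ne, hy.ne, hz.ne, hx.ne', hy.ne', hz.ne', hxy.symm, hxz.symm, hyz.symm]
  · intro a b
    change G.Adj (![c, x, y, z] a) (![c, x, y, z] b) ↔ claw.Adj a b
    fin_cases a <;> fin_cases b <;>
      simp [claw, hx, hy, hz, hx.symm, hy.symm, hz.symm, h₁, h₂, h₃,
        G.adj_comm y x, G.adj_comm z x, G.adj_comm z y]

/-- In a butterfly-free graph, two triangles with exactly one common vertex are joined by an
edge avoiding that vertex. -/
theorem InducedFree.adj_of_butterfly {V : Type*} {G : SimpleGraph V}
    (h : InducedFree butterfly G) {c w x y z : V}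
    (hw : G.Adj c w) (hx : G.Adj c x) (hy : G.Adj c y) (hz : G.Adj c z)
    (hwx : G.Adj w x) (hyz : G.Adj y z)
    (hwy' : w ≠ y) (hwz' : w ≠ z) (hxy' : x ≠ y) (hxz' : x ≠ z) :
    G.Adj w y ∨ G.Adj w z ∨ G.Adj x y ∨ G.Adj x z := by
  by_contra! hn
  obtain ⟨h₁, h₂, h₃, h₄⟩ := hn
  refine h.false ⟨⟨![c, w, x, y, z], ?_⟩, ?_⟩
  · intro a b hab
    fin_cases a <;> fin_cases b <;>
      simp_all [hw.ne, hx.ne, hy.ne, hz.ne, hw.ne', hx.ne', hy.ne', hz.ne', hwx.ne, hwx.ne',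
        hyz.ne, hyz.ne', hwy'.symm, hwz'.symm, hxy'.symm, hxz'.symm]
  · intro a b
    change G.Adj (![c, w, x, y, z] a) (![c, w, x, y, z] b) ↔ butterfly.Adj a b
    fin_cases a <;> fin_cases b <;>
      simp [butterfly, hw, hx, hy, hz, hw.symm, hx.symm, hy.symm, hz.symm, hwx, hwx.symm,
        hyz, hyz.symm, h₁, h₂, h₃, h₄, G.adj_comm y w, G.adj_comm z w, G.adj_comm y x,
        G.adj_comm z x]

theorem stmt_1 {V : Type*} (G : SimpleGraph V)
    (hclaw : InducedFree claw G) (hbutterfly : InducedFree butterfly G)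
    (k t : ℕ) (hk : 3 ≤ k) (ht : 1 ≤ t) (u : ℕ → V)
    (hu_inj : ∀ a b, 1 ≤ a → a ≤ k + 1 → 1 ≤ b → b ≤ k + 1 → u a = u b → a = b)
    (hu_adj : ∀ a b, 1 ≤ a → a ≤ k + 1 → 1 ≤ b → b ≤ k + 1 →
      (G.Adj (u a) (u b) ↔ (a = b + 1 ∨ b = a + 1)))
    (v : ℕ → V)
    (hv_inj : ∀ a b, 1 ≤ a → a ≤ t → 1 ≤ b → b ≤ t → v a = v b → a = b)
    (hv_notin : ∀ a b, 1 ≤ a → a ≤ t → 1 ≤ b → b ≤ k + 1 → v a ≠ u b)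
    (hv_end : ∀ a, 1 ≤ a → a ≤ t → G.Adj (v a) (u (k + 1)))
    (hv_notk : ∀ a, 1 ≤ a → a ≤ t → ¬ G.Adj (v a) (u k))
    (i j : ℕ) (hi1 : 2 ≤ i) (hik : i ≤ k - 1) (hj1 : 1 ≤ j) (hjt : j ≤ t)
    (hji : G.Adj (v j) (u i)) (hji' : G.Adj (v j) (u (i - 1))) :
    ∀ q, 1 ≤ q → q ≤ t → G.Adj (v q) (u i) ∨ G.Adj (v q) (u (i - 1)) := by
  intro q hq1 hqt
  by_cases hqj : q = j
  · exact Or.inl (hqj ▸ hji)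
  have hlast : G.Adj (u (k + 1)) (u k) :=
    (hu_adj _ _ (by omega) (by omega) (by omega) (by omega)).2 (by omega)
  have hstep : G.Adj (u i) (u (i - 1)) :=
    (hu_adj _ _ (by omega) (by omega) (by omega) (by omega)).2 (by omega)
  have hfar : ∀ a, 1 ≤ a → a ≤ k - 1 → ¬ G.Adj (u a) (u (k + 1)) ∧ u a ≠ u (k + 1) := by
    refine fun a ha hak => ⟨fun hadj => ?_, fun heq => ?_⟩
    · have := (hu_adj _ _ ha (by omega) (by omega) (by omega)).1 hadj
      omega
    · have := hu_inj _ _ ha (by omega) (by omega) (by omega) heq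
      omega
  obtain ⟨hi_adj, hi_ne⟩ := hfar i (by omega) hik
  obtain ⟨hi_adj', hi_ne'⟩ := hfar (i - 1) (by omega) (by omega)
  have hvv : G.Adj (v j) (v q) := by
    rcases hclaw.adj_of_claw (hv_end j hj1 hjt).symm (hv_end q hq1 hqt).symm hlast
      (fun h => hqj (hv_inj _ _ hj1 hjt hq1 hqt h).symm)
      (hv_notin j k hj1 hjt (by omega) (by omega))
      (hv_notin q k hq1 hqt (by omega) (by omega)) with h | h | h
    · exact h
    · exact absurd h (hv_notk j hj1 hjt)
    · exact absurd h (hv_notk q hq1 hqt)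
  rcases hbutterfly.adj_of_butterfly hji hji' hvv (hv_end j hj1 hjt) hstep (hv_end q hq1 hqt)
    (hv_notin q i hq1 hqt (by omega) (by omega)).symm hi_ne
    (hv_notin q (i - 1) hq1 hqt (by omega) (by omega)).symm hi_ne' with h | h | h | h
  · exact Or.inl h.symm
  · exact absurd h hi_adj
  · exact Or.inr h.symm
  · exact absurd h hi_adj'
end

section
/- Let G be an E-free simple graph, let k ≥ 6 be an integer, let u_1, u_2, …, u_{k+1} be the vertices, in order, of an induced path in G, and let v be a vertex of G not lying on the path such that v is adjacent to u_{k+1} and v is not adjacent to u_k. If 3 ≤ i ≤ k−3 and v is adjacent to u_i, then v is adjacent to at least one of u_{i-2}, u_{i-1}, u_{i+1}. -/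
/-- The `E` graph: the 6-vertex tree obtained from the claw by subdividing two of
its edges.  Vertices `0,1,2,3,4` form a path and vertex `5` is pendant at `2`. -/
def Egraph : SimpleGraph (Fin 6) :=
  SimpleGraph.fromRel (fun i j =>
    (i = 0 ∧ j = 1) ∨ (i = 1 ∧ j = 2) ∨ (i = 2 ∧ j = 3) ∨ (i = 3 ∧ j = 4) ∨ (i = 2 ∧ j = 5))

theorem stmt_2 {V : Type*} (G : SimpleGraph V) (hE : InducedFree Egraph G)
    (k : ℕ) (hk : 6 ≤ k) (u : ℕ → V)
    (hu_inj : ∀ a b, 1 ≤ a → a ≤ k + 1 → 1 ≤ b → b ≤ k + 1 → u a = u b → a = b)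
    (hu_adj : ∀ a b, 1 ≤ a → a ≤ k + 1 → 1 ≤ b → b ≤ k + 1 →
      (G.Adj (u a) (u b) ↔ (a = b + 1 ∨ b = a + 1)))
    (v : V) (hv_notin : ∀ a, 1 ≤ a → a ≤ k + 1 → v ≠ u a)
    (hv_end : G.Adj v (u (k + 1))) (hv_notk : ¬ G.Adj v (u k))
    (i : ℕ) (hi1 : 3 ≤ i) (hik : i ≤ k - 3) (hvi : G.Adj v (u i)) :
    G.Adj v (u (i - 2)) ∨ G.Adj v (u (i - 1)) ∨ G.Adj v (u (i + 1)) := by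
  by_contra! h
  obtain ⟨h1, h2, h3⟩ := h
  obtain ⟨j, rfl⟩ : ∃ j, i = j + 2 := ⟨i - 2, by omega⟩
  have e1 : j + 2 - 2 = j := by omega
  have e2 : j + 2 - 1 = j + 1 := by omega
  rw [e1] at h1
  rw [e2] at h2
  have hv : ∀ a, G.Adj (u a) v ↔ G.Adj v (u a) := fun a => G.adj_comm _ _
  have hne : ∀ a b, 1 ≤ a → a ≤ k + 1 → 1 ≤ b → b ≤ k + 1 → a ≠ b → u a ≠ u b :=
    fun a b ha ha' hb hb' hab h => hab (hu_inj a b ha ha' hb hb' h)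
  let f : Fin 6 → V := ![u j, u (j + 1), u (j + 2), v, u (k + 1), u (j + 3)]
  have hf : Function.Injective f := by
    intro x y hxy
    fin_cases x <;> fin_cases y <;> first
      | rfl
      | exact absurd hxy (hne _ _ (by omega) (by omega) (by omega) (by omega) (by omega))
      | exact absurd hxy (hv_notin _ (by omega) (by omega))
      | exact absurd hxy.symm (hv_notin _ (by omega) (by omega))
  refine hE.false ⟨⟨f, hf⟩, ?_⟩
  intro x y
  change G.Adj (f x) (f y) ↔ _
  fin_cases x <;> fin_cases y <;> simp [f, Egraph, hv, h1, h2, h3, hvi, hv_end] <;>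
    try (rw [hu_adj _ _ (by omega) (by omega) (by omega) (by omega)]; omega)
end

section
/- Let G be a simple graph and H the clique substitution of G. Then H is C_4-free, i.e., H contains no induced cycle on 4 vertices. -/
/-- The clique substitution of a simple graph `G`: the vertex set is
`{(v,u) : v ∈ V(G), u ∈ N_G(v)}`; two distinct vertices are adjacent iff they
have the same first coordinate (the cliques `K^v`), or they are `(u,v)` and
`(v,u)` for an edge `uv` of `G`. -/
def cliqueSub {V : Type*} (G : SimpleGraph V) :
    SimpleGraph {p : V × V // G.Adj p.1 p.2} :=
  SimpleGraph.fromRel (fun a b => a.1.1 = b.1.1 ∨ (a.1.1 = b.1.2 ∧ a.1.2 = b.1.1))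

theorem cliqueSub_adj {V : Type*} {G : SimpleGraph V} {a b : {p : V × V // G.Adj p.1 p.2}} :
    (cliqueSub G).Adj a b ↔
      a ≠ b ∧ (a.1.1 = b.1.1 ∨ (a.1.1 = b.1.2 ∧ a.1.2 = b.1.1)) := by
  rw [cliqueSub, SimpleGraph.fromRel_adj]
  grind

theorem stmt_4 {V : Type*} (G : SimpleGraph V) :
    InducedFree (SimpleGraph.cycleGraph 4) (cliqueSub G) := by
  refine ⟨fun f => ?_⟩
  have adj (i j : Fin 4) := (f.map_adj_iff (v := i) (w := j)).symm.trans cliqueSub_adj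
  have ne {i j : Fin 4} (h : i ≠ j) : f i ≠ f j := f.injective.ne h
  have h01 := (adj 0 1).1 (by decide)
  have h12 := (adj 1 2).1 (by decide)
  have h23 := (adj 2 3).1 (by decide)
  have h30 := (adj 3 0).1 (by decide)
  have h02 := (adj 0 2).not.1 (by decide)
  have h13 := (adj 1 3).not.1 (by decide)
  have n02 : f 0 ≠ f 2 := ne (by decide)
  have n13 : f 1 ≠ f 3 := ne (by decide)
  clear adj ne
  generalize f 0 = a, f 1 = b, f 2 = c, f 3 = d at *
  obtain ⟨⟨a₁, a₂⟩, ha⟩ := a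
  obtain ⟨⟨b₁, b₂⟩, hb⟩ := b
  obtain ⟨⟨c₁, c₂⟩, hc⟩ := c
  obtain ⟨⟨d₁, d₂⟩, hd⟩ := d
  simp only [ne_eq, Subtype.mk.injEq, Prod.mk.injEq] at *
  grind [SimpleGraph.Adj.ne]
end

section
/- Let G be a simple graph and H the clique substitution of G. Then H is C_5-free, i.e., H contains no induced cycle on 5 vertices. -/
/-- Along an induced path `a b c` of the clique substitution, exactly one of the two edges
lies in one of the cliques `K^v`. -/
theorem cliqueSub_fst_eq_iff_of_not_adj {V : Type*} {G : SimpleGraph V}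
    {a b c : {p : V × V // G.Adj p.1 p.2}} (hab : (cliqueSub G).Adj a b)
    (hbc : (cliqueSub G).Adj b c) (hne : a ≠ c) (hac : ¬ (cliqueSub G).Adj a c) :
    a.1.1 = b.1.1 ↔ ¬ b.1.1 = c.1.1 := by
  rw [cliqueSub_adj] at hab hbc hac
  have hext : ¬ (a.1.1 = c.1.1 ∧ a.1.2 = c.1.2) := fun h => hne (Subtype.ext (Prod.ext h.1 h.2))
  grind

theorem stmt_5 {V : Type*} (G : SimpleGraph V) :
    InducedFree (SimpleGraph.cycleGraph 5) (cliqueSub G) := by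
  refine ⟨fun f => ?_⟩
  have alternate (i j k : Fin 5) (hij : (SimpleGraph.cycleGraph 5).Adj i j)
      (hjk : (SimpleGraph.cycleGraph 5).Adj j k) (hne : i ≠ k)
      (hik : ¬ (SimpleGraph.cycleGraph 5).Adj i k) :
      (f i).1.1 = (f j).1.1 ↔ ¬ (f j).1.1 = (f k).1.1 :=
    cliqueSub_fst_eq_iff_of_not_adj (f.map_adj_iff.2 hij) (f.map_adj_iff.2 hjk)
      (f.injective.ne hne) (mt f.map_adj_iff.1 hik)
  have h₀ := alternate 0 1 2 (by decide) (by decide) (by decide) (by decide)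
  have h₁ := alternate 1 2 3 (by decide) (by decide) (by decide) (by decide)
  have h₂ := alternate 2 3 4 (by decide) (by decide) (by decide) (by decide)
  have h₃ := alternate 3 4 0 (by decide) (by decide) (by decide) (by decide)
  have h₄ := alternate 4 0 1 (by decide) (by decide) (by decide) (by decide)
  tauto
end

section
/- Let p ≥ 1 be an integer, let G be a simple graph in which every path has at most p vertices, and let H be the clique substitution of G. Then H is P_{2p+1}-free, i.e., H contains no induced path on 2p+1 vertices. -/
/-- A sequence of vertices moving along edges or standing still, in which equal values occur only
at consecutive positions, shortcuts to a path visiting at least half as many vertices. -/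
theorem exists_isPath_of_lazy_seq {V : Type*} (G : SimpleGraph V) (f : ℕ → V) (N : ℕ)
    (hstep : ∀ i < N, f i = f (i + 1) ∨ G.Adj (f i) (f (i + 1)))
    (hinj : ∀ i j, i < j → j ≤ N → f i = f j → j = i + 1) (n : ℕ) (hn : n ≤ N) :
    ∃ w : G.Walk (f n) (f 0), w.IsPath ∧ (∀ v ∈ w.support, ∃ i ≤ n, f i = v) ∧
      n + 1 ≤ 2 * (w.length + 1) ∧
      (n + 2 ≤ 2 * (w.length + 1) ∨ ∃ m, n = m + 1 ∧ f m = f n) := by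
  induction n with
  | zero => exact ⟨.nil, by simp, by simp, by simp, by simp⟩
  | succ n ih =>
    obtain ⟨w, hw, hsupp, hlen₀, hlen⟩ := ih (by omega)
    by_cases h : f n = f (n + 1)
    · have hlen' : n + 2 ≤ 2 * (w.length + 1) := by
        refine hlen.resolve_right ?_
        rintro ⟨m, rfl, hm⟩
        have := hinj m (m + 1 + 1) (by omega) hn (hm.trans h)
        omega
      refine ⟨w.copy h rfl, by simpa using hw, fun v hv => ?_, by rwa [SimpleGraph.Walk.length_copy],
        Or.inr ⟨n, rfl, h⟩⟩
      obtain ⟨i, hi, rfl⟩ := hsupp v (by simpa using hv)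
      exact ⟨i, by omega, rfl⟩
    · have hadj := ((hstep n (by omega)).resolve_left h).symm
      have hnot : f (n + 1) ∉ w.support := fun hv => by
        obtain ⟨i, hi, hfi⟩ := hsupp _ hv
        have := hinj i (n + 1) (by omega) hn hfi
        obtain rfl : i = n := by omega
        exact h hfi
      have hlen' : n + 1 + 2 ≤ 2 * ((SimpleGraph.Walk.cons hadj w).length + 1) := by
        rw [SimpleGraph.Walk.length_cons]
        omega
      refine ⟨.cons hadj w, hw.cons hnot, fun v hv => ?_, by omega, Or.inl hlen'⟩
      rw [SimpleGraph.Walk.support_cons, List.mem_cons] at hv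
      obtain rfl | hv := hv
      · exact ⟨n + 1, le_rfl, rfl⟩
      · obtain ⟨i, hi, rfl⟩ := hsupp v hv
        exact ⟨i, by omega, rfl⟩

theorem cliqueSub_adj_fst {V : Type*} (G : SimpleGraph V) {a b : {p : V × V // G.Adj p.1 p.2}}
    (h : (cliqueSub G).Adj a b) : a.1.1 = b.1.1 ∨ G.Adj a.1.1 b.1.1 := by
  rw [cliqueSub, SimpleGraph.fromRel_adj] at h
  rcases h.2 with (h | h) | (h | h)
  · exact Or.inl h
  · exact Or.inr (h.2 ▸ a.2)
  · exact Or.inl h.symm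
  · exact Or.inr (h.1 ▸ a.2)

theorem cliqueSub_adj_of_fst_eq {V : Type*} (G : SimpleGraph V)
    {a b : {p : V × V // G.Adj p.1 p.2}} (hne : a ≠ b) (h : a.1.1 = b.1.1) :
    (cliqueSub G).Adj a b := by
  rw [cliqueSub, SimpleGraph.fromRel_adj]
  exact ⟨hne, Or.inl (Or.inl h)⟩

theorem stmt_6 {V : Type*} (G : SimpleGraph V) (p : ℕ) (hp : 1 ≤ p)
    (hpath : ∀ (a b : V) (w : G.Walk a b), w.IsPath → w.length + 1 ≤ p) :
    InducedFree (SimpleGraph.pathGraph (2 * p + 1)) (cliqueSub G) := by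
  refine ⟨fun e => ?_⟩
  have hp0 : 0 < 2 * p + 1 := by omega
  let x : ℕ → Fin (2 * p + 1) := fun i => ⟨i % (2 * p + 1), Nat.mod_lt _ hp0⟩
  have hx : ∀ i ≤ 2 * p, (x i : ℕ) = i := fun i hi => Nat.mod_eq_of_lt (by omega)
  obtain ⟨w, hw, -, hlen, -⟩ := exists_isPath_of_lazy_seq G (fun i => (e (x i)).1.1) (2 * p)
    (fun i hi => cliqueSub_adj_fst G (e.map_adj_iff.2 (SimpleGraph.pathGraph_adj.2 (Or.inl (by
      rw [hx i (by omega), hx (i + 1) (by omega)])))))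
    (fun i j hij hj h => by
      have hne : x i ≠ x j := fun hxy => by
        have := congrArg Fin.val hxy
        rw [hx i (by omega), hx j hj] at this
        omega
      have hadj := SimpleGraph.pathGraph_adj.1
        (e.map_adj_iff.1 (cliqueSub_adj_of_fst_eq G (e.injective.ne hne) h))
      rw [hx i (by omega), hx j hj] at hadj
      omega)
    (2 * p) le_rfl
  have := hpath _ _ w hw
  omega
end

section
/- Let G be a simple graph and H the clique substitution of G. Then H is butterfly-free, i.e., H contains no induced subgraph isomorphic to the butterfly. -/
/-- Any two vertices of a triangle in the clique substitution lie in the same clique `K^v`. -/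
theorem fst_eq_of_cliqueSub_triangle {V : Type*} {G : SimpleGraph V}
    {a b c : {p : V × V // G.Adj p.1 p.2}} (hab : (cliqueSub G).Adj a b)
    (hac : (cliqueSub G).Adj a c) (hbc : (cliqueSub G).Adj b c) : a.1.1 = b.1.1 := by
  rw [cliqueSub_adj] at hab hac hbc
  have ha := a.2.ne
  obtain ⟨⟨a₁, a₂⟩, _⟩ := a
  obtain ⟨⟨b₁, b₂⟩, _⟩ := b
  obtain ⟨⟨c₁, c₂⟩, _⟩ := c
  simp only [ne_eq, Subtype.mk.injEq, Prod.mk.injEq] at *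
  grind

theorem stmt_9 {V : Type*} (G : SimpleGraph V) :
    InducedFree butterfly (cliqueSub G) := by
  refine ⟨fun f => ?_⟩
  have adj {i j : Fin 5} (h : butterfly.Adj i j) : (cliqueSub G).Adj (f i) (f j) :=
    f.map_adj_iff.2 h
  have h₁ : (f 0).1.1 = (f 1).1.1 := by
    apply fst_eq_of_cliqueSub_triangle (c := f 2) <;> apply adj <;> simp [butterfly]
  have h₃ : (f 0).1.1 = (f 3).1.1 := by
    apply fst_eq_of_cliqueSub_triangle (c := f 4) <;> apply adj <;> simp [butterfly]
  have h : (cliqueSub G).Adj (f 1) (f 3) :=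
    cliqueSub_adj.2 ⟨f.injective.ne (by decide), .inl (h₁.symm.trans h₃)⟩
  have : butterfly.Adj 1 3 := f.map_adj_iff.1 h
  simp [butterfly] at this
end
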